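/- Let S be an inverse semigroup with zero such that (BIS1) the set E(S) of idempotents, under the natural partial order, is a generalized Boolean algebra, and (BIS2a) every pair of orthogonal elements of S has a least upper bound in S. Then every pair of compatible elements of S has a least upper bound in S; that is, S is a Boolean inverse semigroup. -/

import Mathlib

/-- An inverse semigroup: every element has a unique inverse. -/
class InverseSemigroup (S : Type*) extends Semigroup S, Inv S where
  mul_inv_mul : ∀ a : S, a * a⁻¹ * a = a
  inv_mul_inv : ∀ a : S, a⁻¹ * a * a⁻¹ = a⁻¹
  inv_unique : ∀ a b : S, a * b * a = a → b * a * b = b → b = a⁻¹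

/-- `a` is an idempotent. -/
def IsIdem {S : Type*} [Mul S] (a : S) : Prop := a * a = a

/-- The natural partial order on an inverse semigroup: `a ≤ b` iff `a = b * e`
for some idempotent `e`. -/
def natLe {S : Type*} [InverseSemigroup S] (a b : S) : Prop :=
  ∃ e : S, IsIdem e ∧ a = b * e

/-- `a` and `b` are compatible: both `a⁻¹ * b` and `a * b⁻¹` are idempotents. -/
def Compatible {S : Type*} [InverseSemigroup S] (a b : S) : Prop :=
  IsIdem (a⁻¹ * b) ∧ IsIdem (a * b⁻¹)

/-- `c` is the least upper bound of `{a, b}` with respect to the natural partial order. -/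
def IsLubPair {S : Type*} [InverseSemigroup S] (a b c : S) : Prop :=
  natLe a c ∧ natLe b c ∧ ∀ d : S, natLe a d → natLe b d → natLe c d

/-- An inverse semigroup with a zero element. -/
class InverseSemigroupWithZero (S : Type*) extends InverseSemigroup S, Zero S where
  zero_mul : ∀ a : S, 0 * a = 0
  mul_zero : ∀ a : S, a * 0 = 0

/-- `a` and `b` are orthogonal: `a⁻¹ * b = 0` and `a * b⁻¹ = 0`. -/
def Orthogonal {S : Type*} [InverseSemigroupWithZero S] (a b : S) : Prop :=
  a⁻¹ * b = 0 ∧ a * b⁻¹ = 0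

/-- `g` is the least upper bound of the idempotents `e, f` within the idempotents. -/
def IsLubInIdem {S : Type*} [InverseSemigroup S] (e f g : S) : Prop :=
  IsIdem g ∧ natLe e g ∧ natLe f g ∧
    ∀ p : S, IsIdem p → natLe e p → natLe f p → natLe g p

namespace InverseSemigroup

variable {S : Type*} [InverseSemigroup S]

theorem isIdem_mul {e f : S} (he : IsIdem e) (hf : IsIdem f) : IsIdem (e * f) := by
  unfold IsIdem at *
  have h₁ := mul_inv_mul (e * f)
  have h₂ := inv_mul_inv (e * f)
  set x := (e * f)⁻¹ with hx
  have hfxe : f * x * e = x := by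
    apply inv_unique
    · calc e * f * (f * x * e) * (e * f) = e * (f * f) * x * (e * e) * f := by
            simp only [mul_assoc]
        _ = e * f := by rw [he, hf]; simpa only [mul_assoc] using h₁
    · calc f * x * e * (e * f) * (f * x * e) = f * (x * ((e * e) * (f * f)) * x) * e := by
            simp only [mul_assoc]
        _ = f * x * e := by rw [he, hf, h₂]
  have hxx : x * x = x := by
    calc x * x = f * x * e * (f * x * e) := by rw [hfxe]
      _ = f * (x * (e * f) * x) * e := by simp only [mul_assoc]
      _ = x := by rw [h₂, hfxe]
  have hxinv : x = x⁻¹ := inv_unique x x (by rw [hxx, hxx]) (by rw [hxx, hxx])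
  have hef : e * f = x := (inv_unique x (e * f) h₂ h₁).trans hxinv.symm
  rw [hef, hxx]

theorem isIdem_commute {e f : S} (he : IsIdem e) (hf : IsIdem f) : e * f = f * e := by
  have h₁ : e * f * (e * f) = e * f := isIdem_mul he hf
  have h₂ : f * e * (f * e) = f * e := isIdem_mul hf he
  unfold IsIdem at he hf
  have hswap : f * e = (e * f)⁻¹ := by
    apply inv_unique
    · calc e * f * (f * e) * (e * f) = e * (f * f) * (e * e) * f := by simp only [mul_assoc]
        _ = e * f := by rw [he, hf, mul_assoc, h₁]
    · calc f * e * (e * f) * (f * e) = f * (e * e) * (f * f) * e := by simp only [mul_assoc]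
        _ = f * e := by rw [he, hf, mul_assoc, h₂]
  have hself : e * f = (e * f)⁻¹ := inv_unique _ _ (by rw [h₁, h₁]) (by rw [h₁, h₁])
  rw [hswap, ← hself]

theorem inv_eq_self {e : S} (he : IsIdem e) : e⁻¹ = e := by
  unfold IsIdem at he
  exact (inv_unique e e (by rw [he, he]) (by rw [he, he])).symm

theorem inv_inv_eq (a : S) : a⁻¹⁻¹ = a :=
  (inv_unique a⁻¹ a (inv_mul_inv a) (mul_inv_mul a)).symm

theorem isIdem_inv_mul (a : S) : IsIdem (a⁻¹ * a) := by
  unfold IsIdem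
  rw [← mul_assoc, inv_mul_inv]

theorem isIdem_mul_inv (a : S) : IsIdem (a * a⁻¹) := by
  unfold IsIdem
  rw [← mul_assoc, mul_inv_mul]

theorem mul_inv_eq (a b : S) : (a * b)⁻¹ = b⁻¹ * a⁻¹ := by
  have hcomm := isIdem_commute (isIdem_mul_inv b) (isIdem_inv_mul a)
  symm
  apply inv_unique
  · calc a * b * (b⁻¹ * a⁻¹) * (a * b) = a * (b * b⁻¹ * (a⁻¹ * a)) * b := by
          simp only [mul_assoc]
      _ = (a * a⁻¹ * a) * (b * b⁻¹ * b) := by rw [hcomm]; simp only [mul_assoc]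
      _ = a * b := by rw [mul_inv_mul, mul_inv_mul]
  · calc b⁻¹ * a⁻¹ * (a * b) * (b⁻¹ * a⁻¹) = b⁻¹ * (a⁻¹ * a * (b * b⁻¹)) * a⁻¹ := by
          simp only [mul_assoc]
      _ = (b⁻¹ * b * b⁻¹) * (a⁻¹ * a * a⁻¹) := by rw [← hcomm]; simp only [mul_assoc]
      _ = b⁻¹ * a⁻¹ := by rw [inv_mul_inv, inv_mul_inv]

theorem natLe_trans {a b c : S} (hab : natLe a b) (hbc : natLe b c) : natLe a c := by
  obtain ⟨e, he, rfl⟩ := hab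
  obtain ⟨f, hf, rfl⟩ := hbc
  exact ⟨f * e, isIdem_mul hf he, mul_assoc _ _ _⟩

theorem mul_natLe (a : S) {e : S} (he : IsIdem e) : natLe (a * e) a := ⟨e, he, rfl⟩

theorem idem_mul_natLe (a : S) {e : S} (he : IsIdem e) : natLe (e * a) a := by
  have hcomm := isIdem_commute he (isIdem_mul_inv a)
  refine ⟨a⁻¹ * e * a, ?_, ?_⟩
  · calc a⁻¹ * e * a * (a⁻¹ * e * a) = a⁻¹ * (e * (a * a⁻¹)) * (e * a) := by
          simp only [mul_assoc]
      _ = (a⁻¹ * a * a⁻¹) * (e * e) * a := by rw [hcomm]; simp only [mul_assoc]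
      _ = a⁻¹ * e * a := by rw [inv_mul_inv, he]
  · calc e * a = e * (a * a⁻¹ * a) := by rw [mul_inv_mul]
      _ = e * (a * a⁻¹) * a := by simp only [mul_assoc]
      _ = a * (a⁻¹ * e * a) := by rw [hcomm]; simp only [mul_assoc]

theorem mul_eq_of_natLe_idem {e f : S} (hf : IsIdem f) (h : natLe e f) : f * e = e := by
  obtain ⟨p, -, rfl⟩ := h
  rw [← mul_assoc, hf]

theorem isIdem_of_natLe_idem {a f : S} (hf : IsIdem f) (h : natLe a f) : IsIdem a := by
  obtain ⟨p, hp, rfl⟩ := h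
  exact isIdem_mul hf hp

/-- Multiplying an element by an idempotent below its domain and passing to a larger element. -/
theorem mul_eq_mul_of_natLe {a c e : S} (he : IsIdem e) (hea : a⁻¹ * a * e = e)
    (h : natLe (a * e) c) : c * e = a * e := by
  obtain ⟨p, hp, hcp⟩ := h
  have hep : e * p = e := by
    have haep : a * e * p = a * e := by rw [hcp, mul_assoc, hp]
    calc e * p = a⁻¹ * (a * e * p) := by nth_rw 1 [← hea]; simp only [mul_assoc]
      _ = e := by rw [haep, ← mul_assoc, hea]
  calc c * e = c * (p * e) := by rw [isIdem_commute hp he, hep]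
    _ = a * e := by rw [← mul_assoc, ← hcp, mul_assoc, he]

theorem _root_.Compatible.inv_mul_comm {a b : S} (h : Compatible a b) : b⁻¹ * a = a⁻¹ * b := by
  have := inv_eq_self h.1
  rwa [mul_inv_eq, inv_inv_eq] at this

theorem _root_.Compatible.mul_inv_comm {a b : S} (h : Compatible a b) : b * a⁻¹ = a * b⁻¹ := by
  have := inv_eq_self h.2
  rwa [mul_inv_eq, inv_inv_eq] at this

theorem _root_.Compatible.mul_dom_eq {a b : S} (h : Compatible a b) :
    a * (b⁻¹ * b) = b * (a⁻¹ * a) := by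
  have hf : a⁻¹ * b * (a⁻¹ * b) = a⁻¹ * b := h.1
  have hfb : b⁻¹ * b * (a⁻¹ * b) = a⁻¹ * b := by
    rw [isIdem_commute (isIdem_inv_mul b) h.1]
    calc a⁻¹ * b * (b⁻¹ * b) = a⁻¹ * (b * b⁻¹ * b) := by simp only [mul_assoc]
      _ = a⁻¹ * b := by rw [mul_inv_mul]
  have hab : a * (b⁻¹ * b) = b * (a⁻¹ * b) := by
    rw [← mul_assoc, ← mul_assoc, h.mul_inv_comm]
  have hba : b * (a⁻¹ * a) = a * (a⁻¹ * b) := by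
    rw [← h.inv_mul_comm, ← mul_assoc, ← mul_assoc, h.mul_inv_comm]
  calc a * (b⁻¹ * b) = b * (a⁻¹ * b) * (a⁻¹ * b) := by rw [mul_assoc, hf, hab]
    _ = a * (b⁻¹ * b * (a⁻¹ * b)) := by rw [← hab]; simp only [mul_assoc]
    _ = b * (a⁻¹ * a) := by rw [hfb, hba]

end InverseSemigroup

namespace InverseSemigroupWithZero

open InverseSemigroup

variable {S : Type*} [InverseSemigroupWithZero S]

/-- If orthogonal joins exist in `S`, a join of orthogonal idempotents among the idempotents is
their join in `S`. -/
theorem natLe_of_isLubInIdem (hOrth : ∀ a b : S, Orthogonal a b → ∃ c : S, IsLubPair a b c)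
    {e g f y : S} (he : IsIdem e) (hg : IsIdem g) (heg : e * g = 0) (hf : IsLubInIdem e g f)
    (hey : natLe e y) (hgy : natLe g y) : natLe f y := by
  obtain ⟨hfi, hef, hgf, hmin⟩ := hf
  obtain ⟨j, hej, hgj, hj⟩ := hOrth e g
    ⟨by rw [inv_eq_self he, heg], by rw [inv_eq_self hg, heg]⟩
  have hji : IsIdem j := isIdem_of_natLe_idem hfi (hj f hef hgf)
  exact natLe_trans (hmin j hji hej hgj) (hj y hey hgy)

theorem natLe_of_mul_natLe (hOrth : ∀ a b : S, Orthogonal a b → ∃ c : S, IsLubPair a b c)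
    {a c e g : S} (he : IsIdem e) (hg : IsIdem g) (heg : e * g = 0)
    (hlub : IsLubInIdem e g (a⁻¹ * a)) (hec : natLe (a * e) c) (hgc : natLe (a * g) c) :
    natLe a c := by
  have below {p : S} (hp : IsIdem p) (hpa : natLe p (a⁻¹ * a)) (hpc : natLe (a * p) c) :
      natLe p (a⁻¹ * c) := by
    have hdp := mul_eq_of_natLe_idem (isIdem_inv_mul a) hpa
    exact ⟨p, hp, by rw [mul_assoc, mul_eq_mul_of_natLe hp hdp hpc, ← mul_assoc, hdp]⟩
  obtain ⟨p, hp, hap⟩ := natLe_of_isLubInIdem hOrth he hg heg hlub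
    (below he hlub.2.1 hec) (below hg hlub.2.2.1 hgc)
  have ha : a = a * a⁻¹ * (c * p) := by
    rw [mul_assoc, ← mul_assoc a⁻¹, ← hap, ← mul_assoc, mul_inv_mul]
  rw [ha]
  exact natLe_trans (idem_mul_natLe _ (isIdem_mul_inv a)) (mul_natLe c hp)

/-- Cutting `a` down by an idempotent `g` disjoint from the domain of `b` makes it
orthogonal to `b`. -/
theorem _root_.Compatible.orthogonal_mul {a b g : S} (h : Compatible a b) (hg : IsIdem g)
    (hgb : g * (b⁻¹ * b) = 0) : Orthogonal (a * g) b := by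
  have hfb : b⁻¹ * b * (a⁻¹ * b) = a⁻¹ * b := by
    rw [isIdem_commute (isIdem_inv_mul b) h.1, mul_assoc, ← mul_assoc b, mul_inv_mul]
  constructor
  · rw [mul_inv_eq, inv_eq_self hg, mul_assoc, ← hfb, ← mul_assoc, hgb, zero_mul]
  · rw [← inv_mul_inv b, mul_assoc, ← mul_assoc g, hgb, zero_mul, mul_zero]

end InverseSemigroupWithZero

open InverseSemigroup InverseSemigroupWithZero in
/-- (BIS1) + (BIS2a) imply (BIS2): if the idempotents form a generalized Boolean
algebra and orthogonal joins exist, then all compatible joins exist. -/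
theorem statement7 {S : Type*} [InverseSemigroupWithZero S]
    (hJoin : ∀ e f : S, IsIdem e → IsIdem f → ∃ g : S, IsLubInIdem e f g)
    (hDistrib : ∀ e f g fg : S, IsIdem e → IsIdem f → IsIdem g →
      IsLubInIdem f g fg → IsLubInIdem (e * f) (e * g) (e * fg))
    (hRelCompl : ∀ e f : S, IsIdem e → IsIdem f → natLe e f →
      ∃ g : S, IsIdem g ∧ e * g = 0 ∧ IsLubInIdem e g f)
    (hOrth : ∀ a b : S, Orthogonal a b → ∃ c : S, IsLubPair a b c) :
    ∀ a b : S, Compatible a b → ∃ c : S, IsLubPair a b c := by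
  intro a b hab
  have hda := isIdem_inv_mul a
  have hdb := isIdem_inv_mul b
  have he := isIdem_mul hda hdb
  obtain ⟨g, hg, heg, hlub⟩ := hRelCompl _ _ he hda (mul_natLe _ hdb)
  have hgb : g * (b⁻¹ * b) = 0 := by
    rw [← mul_eq_of_natLe_idem hda hlub.2.2.1, isIdem_commute (isIdem_mul hda hg) hdb,
      ← mul_assoc, isIdem_commute hdb hda, heg]
  obtain ⟨c, hagc, hbc, hc⟩ := hOrth _ _ (hab.orthogonal_mul hg hgb)
  refine ⟨c, ?_, hbc, fun d had hbd => hc d (natLe_trans (mul_natLe a hg) had) hbd⟩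
  refine natLe_of_mul_natLe hOrth he hg heg hlub ?_ hagc
  have hae : a * (a⁻¹ * a * (b⁻¹ * b)) = b * (a⁻¹ * a) := by
    rw [← mul_assoc, ← mul_assoc a, mul_inv_mul, hab.mul_dom_eq]
  rw [hae]
  exact natLe_trans (mul_natLe b hda) hbc
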